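/- Concentration of empirical averages controlled by the dual Lipschitz distance: fix g : ℕ → ℝ nondecreasing with g(0) = 0, g(k) > 0 for k ≥ 1, satisfying the gap condition, and fix 0 < λ₀ ≤ λ₁ and B > 0. Then there exists C > 0 (depending only on g, λ₀, λ₁, B) such that the following holds for all integers d, N ≥ 1 with T := {0,…,N−1}^d: let (λ_x)_{x∈T} with λ_x ∈ [λ₀, λ₁], let ν := ⊗_{x∈T} n_{λ_x} be the corresponding product probability measure on ℕ^T and m_x := R(λ_x); let μ be any probability measure on ℕ^T with finite first moment, and let φ : T → ℝ with |φ_x| ≤ B for all x. Then for every ε > 0, μ( { η ∈ ℕ^T : | N^{−d} Σ_{x∈T} φ_x (η_x − m_x) | > ε } ) ≤ C ε^{−1} ( ‖μ − ν‖_{Lip*} + N^{−d/2} ). -/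

import Mathlib

open Finset Real

/-- `gFact g k = g(k)! := g(1)g(2)⋯g(k)`, with `g(0)! = 1`. -/
noncomputable def gFact (g : ℕ → ℝ) : ℕ → ℝ
  | 0 => 1
  | k + 1 => gFact g k * g (k + 1)

/-- The partition function `Z(λ) = Σ_k λ^k / g(k)!`. -/
noncomputable def Zfun (g : ℕ → ℝ) (l : ℝ) : ℝ := ∑' k : ℕ, l ^ k / gFact g k

/-- The mean density `R(λ) = Σ_k k λ^k / (g(k)! Z(λ))`. -/
noncomputable def Rfun (g : ℕ → ℝ) (l : ℝ) : ℝ :=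
  ∑' k : ℕ, (k : ℝ) * l ^ k / (gFact g k * Zfun g l)

/-- The one-site equilibrium weight `n_λ(k) = λ^k / (g(k)! Z(λ))`. -/
noncomputable def nWeight (g : ℕ → ℝ) (l : ℝ) (k : ℕ) : ℝ := l ^ k / (gFact g k * Zfun g l)

/-- The gap condition on the jump rate `g`: there are `n₀` and `c_g > 0` with
`g(n') − g(n) ≥ c_g` whenever `n' ≥ n + n₀`. -/
def GapCondition (g : ℕ → ℝ) : Prop :=
  ∃ n₀ : ℕ, ∃ cg : ℝ, 0 < cg ∧ ∀ n n' : ℕ, n + n₀ ≤ n' → cg ≤ g n' - g n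

open MeasureTheory

/-- The one-site zero-range equilibrium measure `n_λ` on ℕ. -/
noncomputable def nMeasure (g : ℕ → ℝ) (l : ℝ) : Measure ℕ :=
  Measure.sum fun k => ENNReal.ofReal (nWeight g l k) • Measure.dirac k

/-- The dual Lipschitz (Monge–Kantorovich) distance between two measures on `ℕ^T`, with the
`ℓ¹` distance on configurations normalised by the constant `c`. -/
noncomputable def lipDual {T : Type*} [Fintype T] (c : ℝ) (μ ν : Measure (T → ℕ)) : ℝ :=
  ⨆ Φ : {Φ : (T → ℕ) → ℝ //
      ∀ η ζ : T → ℕ, |Φ η - Φ ζ| ≤ c * ∑ x : T, |(η x : ℝ) - (ζ x : ℝ)|},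
    |∫ η, Φ.1 η ∂μ - ∫ η, Φ.1 η ∂ν|

section OneSite

variable {g : ℕ → ℝ}

lemma gFact_pos (hgpos : ∀ k : ℕ, 0 < k → 0 < g k) (k : ℕ) : 0 < gFact g k := by
  induction k with
  | zero => exact one_pos
  | succ k ih => exact mul_pos ih (hgpos _ k.succ_pos)

lemma GapCondition.tendsto_atTop (hgap : GapCondition g) (hg0 : g 0 = 0) (hgmono : Monotone g) :
    Filter.Tendsto g Filter.atTop Filter.atTop := by
  obtain ⟨n₀, cg, hcg, h⟩ := hgap
  have hlin : ∀ j : ℕ, j * cg ≤ g (j * n₀) := by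
    intro j
    induction j with
    | zero => simp [hg0]
    | succ j ih =>
      have := h (j * n₀) ((j + 1) * n₀) (by rw [add_one_mul])
      push_cast
      linarith
  refine Filter.tendsto_atTop_atTop_of_monotone hgmono fun b => ?_
  obtain ⟨j, hj⟩ := exists_nat_ge (b / cg)
  exact ⟨j * n₀, ((div_le_iff₀ hcg).1 hj).trans (hlin j)⟩

lemma summable_pow_div_gFact (hgpos : ∀ k : ℕ, 0 < k → 0 < g k)
    (hg : Filter.Tendsto g Filter.atTop Filter.atTop) {l : ℝ} (hl : 0 < l) :
    Summable fun k : ℕ => l ^ k / gFact g k := by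
  have hpos := gFact_pos hgpos
  refine summable_of_ratio_test_tendsto_lt_one (l := 0) zero_lt_one
    (Filter.Eventually.of_forall fun k => (div_pos (pow_pos hl k) (hpos k)).ne') ?_
  have : Filter.Tendsto (fun k : ℕ => l / g (k + 1)) Filter.atTop (nhds 0) :=
    Filter.Tendsto.const_div_atTop (hg.comp (Filter.tendsto_add_atTop_nat 1)) l
  refine this.congr fun k => ?_
  have h1 := hpos k
  have h2 := hgpos (k + 1) k.succ_pos
  have h3 := hpos (k + 1)
  rw [Real.norm_of_nonneg (by positivity), Real.norm_of_nonneg (by positivity)]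
  simp only [gFact, pow_succ]
  field_simp

lemma summable_sq_mul_pow_div_gFact (hgpos : ∀ k : ℕ, 0 < k → 0 < g k)
    (hg : Filter.Tendsto g Filter.atTop Filter.atTop) {l : ℝ} (hl : 0 < l) :
    Summable fun k : ℕ => (k : ℝ) ^ 2 * (l ^ k / gFact g k) := by
  have hpos := gFact_pos hgpos
  refine (summable_pow_div_gFact hgpos hg (l := 4 * l) (by positivity)).of_nonneg_of_le
    (fun k => ?_) (fun k => ?_)
  · have := hpos k
    positivity
  · have h1 := hpos k
    have h2 : (k : ℝ) ≤ 2 ^ k := mod_cast Nat.lt_two_pow_self.le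
    have h3 : (k : ℝ) ^ 2 ≤ 4 ^ k := by
      calc (k : ℝ) ^ 2 ≤ (2 ^ k) ^ 2 := by gcongr
        _ = 4 ^ k := by rw [← pow_mul, mul_comm, pow_mul]; norm_num
    rw [mul_pow, mul_div_assoc]
    gcongr

lemma one_le_Zfun (hgpos : ∀ k : ℕ, 0 < k → 0 < g k)
    (hg : Filter.Tendsto g Filter.atTop Filter.atTop) {l : ℝ} (hl : 0 < l) :
    1 ≤ Zfun g l := by
  have := (summable_pow_div_gFact hgpos hg hl).le_tsum 0 fun k _ =>
    (div_pos (pow_pos hl k) (gFact_pos hgpos k)).le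
  simpa [Zfun, gFact] using this

lemma nWeight_nonneg (hgpos : ∀ k : ℕ, 0 < k → 0 < g k)
    (hg : Filter.Tendsto g Filter.atTop Filter.atTop) {l : ℝ} (hl : 0 < l) (k : ℕ) :
    0 ≤ nWeight g l k := by
  have h1 := gFact_pos hgpos k
  have h2 := one_le_Zfun hgpos hg hl
  unfold nWeight
  positivity

lemma nWeight_eq_div (l : ℝ) (k : ℕ) : nWeight g l k = l ^ k / gFact g k / Zfun g l := by
  rw [nWeight, div_div]

lemma isProbabilityMeasure_nMeasure (hgpos : ∀ k : ℕ, 0 < k → 0 < g k)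
    (hg : Filter.Tendsto g Filter.atTop Filter.atTop) {l : ℝ} (hl : 0 < l) :
    IsProbabilityMeasure (nMeasure g l) := by
  have hZ := one_le_Zfun hgpos hg hl
  have hs := summable_pow_div_gFact hgpos hg hl
  refine ⟨?_⟩
  rw [nMeasure, Measure.sum_apply _ MeasurableSet.univ]
  simp only [Measure.smul_apply, measure_univ, smul_eq_mul, mul_one]
  rw [← ENNReal.ofReal_tsum_of_nonneg (nWeight_nonneg hgpos hg hl)]
  · simp_rw [nWeight_eq_div]
    rw [tsum_div_const, ← Zfun, div_self (by positivity), ENNReal.ofReal_one]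
  · exact (hs.div_const (Zfun g l)).congr fun k => (nWeight_eq_div l k).symm

lemma integrable_sq_nMeasure (hgpos : ∀ k : ℕ, 0 < k → 0 < g k)
    (hg : Filter.Tendsto g Filter.atTop Filter.atTop) {l : ℝ} (hl : 0 < l) :
    Integrable (fun k : ℕ => (k : ℝ) ^ 2) (nMeasure g l) := by
  refine integrable_sum_dirac (fun _ => ENNReal.ofReal_ne_top) ?_
  refine ((summable_sq_mul_pow_div_gFact hgpos hg hl).div_const (Zfun g l)).congr fun k => ?_
  rw [ENNReal.toReal_ofReal (nWeight_nonneg hgpos hg hl k), nWeight_eq_div,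
    Real.norm_of_nonneg (by positivity)]
  ring

lemma integral_nMeasure (hgpos : ∀ k : ℕ, 0 < k → 0 < g k)
    (hg : Filter.Tendsto g Filter.atTop Filter.atTop) {l : ℝ} (hl : 0 < l) (f : ℕ → ℝ) :
    ∫ k, f k ∂(nMeasure g l) = ∑' k, nWeight g l k * f k := by
  rw [nMeasure, integral_sum_dirac fun _ => ENNReal.ofReal_ne_top]
  simp_rw [ENNReal.toReal_ofReal (nWeight_nonneg hgpos hg hl _), smul_eq_mul]

lemma integral_id_nMeasure (hgpos : ∀ k : ℕ, 0 < k → 0 < g k)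
    (hg : Filter.Tendsto g Filter.atTop Filter.atTop) {l : ℝ} (hl : 0 < l) :
    ∫ k : ℕ, (k : ℝ) ∂(nMeasure g l) = Rfun g l := by
  rw [integral_nMeasure hgpos hg hl, Rfun]
  congr 1 with k
  rw [nWeight]
  ring

lemma memLp_two_nMeasure (hgpos : ∀ k : ℕ, 0 < k → 0 < g k)
    (hg : Filter.Tendsto g Filter.atTop Filter.atTop) {l : ℝ} (hl : 0 < l) :
    MemLp (fun k : ℕ => (k : ℝ)) 2 (nMeasure g l) :=
  (memLp_two_iff_integrable_sq Measurable.of_discrete.aestronglyMeasurable).2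
    (integrable_sq_nMeasure hgpos hg hl)

/-- The variance of `n_l` is bounded by a quantity which depends only on an upper bound for `l`. -/
lemma variance_nMeasure_le (hgpos : ∀ k : ℕ, 0 < k → 0 < g k)
    (hg : Filter.Tendsto g Filter.atTop Filter.atTop) {l l' : ℝ} (hl : 0 < l) (hll' : l ≤ l') :
    ProbabilityTheory.variance (fun k : ℕ => (k : ℝ)) (nMeasure g l)
      ≤ ∑' k : ℕ, (k : ℝ) ^ 2 * (l' ^ k / gFact g k) := by
  have := isProbabilityMeasure_nMeasure hgpos hg hl
  have hZ := one_le_Zfun hgpos hg hl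
  have hpos := gFact_pos hgpos
  refine (ProbabilityTheory.variance_le_expectation_sq
    Measurable.of_discrete.aestronglyMeasurable).trans ?_
  have hs := summable_sq_mul_pow_div_gFact hgpos hg hl
  simp only [Pi.pow_apply]
  rw [integral_nMeasure hgpos hg hl]
  refine Summable.tsum_le_tsum (fun k => ?_) ((hs.div_const (Zfun g l)).congr fun k => ?_)
    (summable_sq_mul_pow_div_gFact hgpos hg (hl.trans_le hll'))
  · have := hpos k
    have h1 : nWeight g l k ≤ l ^ k / gFact g k := by
      rw [nWeight_eq_div]
      exact div_le_self (by positivity) hZ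
    rw [mul_comm]
    gcongr
    exact h1.trans (by gcongr)
  · rw [nWeight_eq_div]
    ring

end OneSite

section Lipschitz

variable {T : Type*} [Fintype T]

lemma integrable_of_lipschitz {c : ℝ} {μ : Measure (T → ℕ)} [IsProbabilityMeasure μ]
    (hμ : Integrable (fun η => ∑ x : T, (η x : ℝ)) μ) {Φ : (T → ℕ) → ℝ}
    (hΦ : ∀ η ζ : T → ℕ, |Φ η - Φ ζ| ≤ c * ∑ x : T, |(η x : ℝ) - (ζ x : ℝ)|) :
    Integrable Φ μ := by
  have h : Integrable (fun η => Φ η - Φ 0) μ := by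
    refine (hμ.const_mul c).mono' Measurable.of_discrete.aestronglyMeasurable
      (Filter.Eventually.of_forall fun η => ?_)
    simpa using hΦ η 0
  exact (h.add (integrable_const (Φ 0))).congr
    (Filter.Eventually.of_forall fun η => sub_add_cancel (Φ η) (Φ 0))

lemma abs_integral_sub_le_lipDual {c : ℝ} {μ ν : Measure (T → ℕ)} [IsProbabilityMeasure μ]
    [IsProbabilityMeasure ν] (hμ : Integrable (fun η => ∑ x : T, (η x : ℝ)) μ)
    (hν : Integrable (fun η => ∑ x : T, (η x : ℝ)) ν) {Φ : (T → ℕ) → ℝ}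
    (hΦ : ∀ η ζ : T → ℕ, |Φ η - Φ ζ| ≤ c * ∑ x : T, |(η x : ℝ) - (ζ x : ℝ)|) :
    |∫ η, Φ η ∂μ - ∫ η, Φ η ∂ν| ≤ lipDual c μ ν := by
  have hkey : ∀ (ρ : Measure (T → ℕ)) [IsProbabilityMeasure ρ],
      Integrable (fun η => ∑ x : T, (η x : ℝ)) ρ → ∀ Ψ : (T → ℕ) → ℝ,
      (∀ η ζ : T → ℕ, |Ψ η - Ψ ζ| ≤ c * ∑ x : T, |(η x : ℝ) - (ζ x : ℝ)|) →
      |∫ η, Ψ η ∂ρ - Ψ 0| ≤ ∫ η, c * ∑ x : T, (η x : ℝ) ∂ρ := by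
    intro ρ _ hρ Ψ hΨ
    have h : ∫ η, Ψ η ∂ρ - Ψ 0 = ∫ η, (Ψ η - Ψ 0) ∂ρ := by
      rw [integral_sub (integrable_of_lipschitz hρ hΨ) (integrable_const _)]
      simp
    rw [h, ← Real.norm_eq_abs]
    refine norm_integral_le_of_norm_le (hρ.const_mul c)
      (Filter.Eventually.of_forall fun η => ?_)
    simpa using hΨ η 0
  refine le_ciSup (f := fun Φ : {Φ : (T → ℕ) → ℝ //
      ∀ η ζ : T → ℕ, |Φ η - Φ ζ| ≤ c * ∑ x : T, |(η x : ℝ) - (ζ x : ℝ)|} =>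
      |∫ η, Φ.1 η ∂μ - ∫ η, Φ.1 η ∂ν|) ?_ ⟨Φ, hΦ⟩
  refine ⟨∫ η, c * ∑ x : T, (η x : ℝ) ∂μ + ∫ η, c * ∑ x : T, (η x : ℝ) ∂ν, ?_⟩
  rintro _ ⟨Ψ, rfl⟩
  have h1 := abs_le.1 (hkey μ hμ Ψ.1 Ψ.2)
  have h2 := abs_le.1 (hkey ν hν Ψ.1 Ψ.2)
  exact abs_le.2 ⟨by linarith, by linarith⟩

lemma abs_weighted_sum_lipschitz {c B : ℝ} (hc : 0 ≤ c) (φ m : T → ℝ) (hφ : ∀ x, |φ x| ≤ B)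
    (η ζ : T → ℕ) :
    |(|c * ∑ x, φ x * ((η x : ℝ) - m x)| - |c * ∑ x, φ x * ((ζ x : ℝ) - m x)|)|
      ≤ B * (c * ∑ x, |(η x : ℝ) - (ζ x : ℝ)|) := by
  refine (abs_abs_sub_abs_le_abs_sub _ _).trans ?_
  rw [← mul_sub, ← Finset.sum_sub_distrib, abs_mul, abs_of_nonneg hc, mul_left_comm,
    Finset.mul_sum]
  refine mul_le_mul_of_nonneg_left ((Finset.abs_sum_le_sum_abs _ _).trans
    (Finset.sum_le_sum fun x _ => ?_)) hc
  rw [← mul_sub, sub_sub_sub_cancel_right, abs_mul]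
  exact mul_le_mul_of_nonneg_right (hφ x) (abs_nonneg _)

end Lipschitz

/-- `L¹` bound for centred weighted sums of independent square-integrable variables. -/
lemma integral_abs_weighted_sum_pi_le {T : Type*} [Fintype T] {ρ : T → Measure ℕ}
    [∀ x, IsProbabilityMeasure (ρ x)] (hρ : ∀ x, MemLp (fun k : ℕ => (k : ℝ)) 2 (ρ x))
    {m φ : T → ℝ} {B V : ℝ} (hm : ∀ x, ∫ k : ℕ, (k : ℝ) ∂(ρ x) = m x)
    (hV : ∀ x, ProbabilityTheory.variance (fun k : ℕ => (k : ℝ)) (ρ x) ≤ V)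
    (hB : 0 ≤ B) (hφ : ∀ x, |φ x| ≤ B) :
    ∫ η, |∑ x, φ x * ((η x : ℝ) - m x)| ∂(Measure.pi ρ) ≤ B * √(Fintype.card T * V) := by
  set S : (T → ℕ) → ℝ := fun η => ∑ x, φ x * ((η x : ℝ) - m x) with hS
  have hX : ∀ x, MemLp (fun k : ℕ => φ x * ((k : ℝ) - m x)) 2 (ρ x) := fun x =>
    ((hρ x).sub (memLp_const (m x))).const_mul (φ x)
  have hXpi : ∀ x, MemLp (fun η : T → ℕ => φ x * ((η x : ℝ) - m x)) 2 (Measure.pi ρ) :=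
    fun x => (hX x).comp_measurePreserving (measurePreserving_eval ρ x)
  have hS2 : MemLp S 2 (Measure.pi ρ) := memLp_finsetSum _ fun x _ => hXpi x
  have hmean : ∫ η, S η ∂(Measure.pi ρ) = 0 := by
    rw [hS, integral_finsetSum _ fun x _ => (hXpi x).integrable one_le_two]
    refine Finset.sum_eq_zero fun x _ => ?_
    rw [integral_comp_eval (μ := ρ) (f := fun k : ℕ => φ x * ((k : ℝ) - m x))
      Measurable.of_discrete.aestronglyMeasurable, integral_const_mul,
      integral_sub ((hρ x).integrable one_le_two) (integrable_const _), hm x]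
    simp
  have hvar : ProbabilityTheory.variance S (Measure.pi ρ) ≤ B ^ 2 * (Fintype.card T * V) := by
    have hSsum : S = ∑ x, fun η : T → ℕ => (fun k : ℕ => φ x * ((k : ℝ) - m x)) (η x) := by
      ext η
      simp [hS]
    rw [hSsum, ProbabilityTheory.variance_sum_pi hX]
    calc _ ≤ ∑ _x : T, B ^ 2 * V := Finset.sum_le_sum fun x _ => ?_
      _ = _ := by simp; ring
    rw [ProbabilityTheory.variance_const_mul,
      ProbabilityTheory.variance_sub_const Measurable.of_discrete.aestronglyMeasurable]
    exact mul_le_mul (sq_le_sq.2 (by rw [abs_of_nonneg hB]; exact hφ x)) (hV x)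
      (ProbabilityTheory.variance_nonneg _ _) (sq_nonneg B)
  rw [ProbabilityTheory.variance_of_integral_eq_zero hS2.aestronglyMeasurable.aemeasurable hmean]
    at hvar
  have hjensen : (∫ η, |S η| ∂(Measure.pi ρ)) ^ 2 ≤ ∫ η, S η ^ 2 ∂(Measure.pi ρ) := by
    have h := ProbabilityTheory.variance_nonneg |S| (Measure.pi ρ)
    rw [ProbabilityTheory.variance_eq_sub hS2.abs] at h
    simpa using h
  rw [← Real.sqrt_sq hB, ← Real.sqrt_mul (sq_nonneg B)]
  exact Real.le_sqrt_of_sq_le (hjensen.trans hvar)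

/-- Concentration of empirical averages controlled by the dual Lipschitz
distance: for `g` nondecreasing with the gap condition, `0 < lam0 ≤ lam1` and `B > 0`, there is
`C > 0` such that for any torus `T = {0,…,N−1}^d`, site-dependent fugacities `λ_x ∈ [lam0,lam1]`
with product equilibrium `ν` and means `m_x = R(λ_x)`, any probability measure `μ` with finite
first moment and any `|φ| ≤ B`,
`μ(|N^{−d} Σ_x φ_x (η_x − m_x)| > ε) ≤ C ε⁻¹ (‖μ − ν‖_{Lip*} + N^{−d/2})`. -/
theorem empirical_average_concentration (g : ℕ → ℝ) (hg0 : g 0 = 0)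
    (hgpos : ∀ k : ℕ, 0 < k → 0 < g k) (hgmono : Monotone g) (hgap : GapCondition g)
    (lam0 lam1 : ℝ) (hlam0 : 0 < lam0) (hlam : lam0 ≤ lam1) (B : ℝ) (hB : 0 < B) :
    ∃ C > (0:ℝ), ∀ d N : ℕ, 1 ≤ d → 1 ≤ N →
      ∀ lam : (Fin d → Fin N) → ℝ, (∀ x, lam x ∈ Set.Icc lam0 lam1) →
      ∀ μ : Measure ((Fin d → Fin N) → ℕ), IsProbabilityMeasure μ →
        Integrable (fun η => ∑ x : Fin d → Fin N, (η x : ℝ)) μ →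
      ∀ φ : (Fin d → Fin N) → ℝ, (∀ x, |φ x| ≤ B) →
      ∀ ε > (0:ℝ),
        (μ {η : (Fin d → Fin N) → ℕ |
            ε < |(N : ℝ) ^ (-(d:ℤ)) *
              ∑ x : Fin d → Fin N, φ x * ((η x : ℝ) - Rfun g (lam x))|}).toReal
          ≤ C * ε⁻¹ *
            (lipDual ((N : ℝ) ^ (-(d:ℤ))) μ (Measure.pi fun x => nMeasure g (lam x))
              + (N : ℝ) ^ (-(d:ℝ) / 2)) := by
  have hg := hgap.tendsto_atTop hg0 hgmono
  set V : ℝ := ∑' k : ℕ, (k : ℝ) ^ 2 * (lam1 ^ k / gFact g k) with hVdef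
  refine ⟨B * (1 + √V), by positivity, ?_⟩
  intro d N _ hN lam hlamx μ hμ hμint φ hφ ε hε
  have hlpos : ∀ x, 0 < lam x := fun x => hlam0.trans_le (hlamx x).1
  have hprob : ∀ x, IsProbabilityMeasure (nMeasure g (lam x)) := fun x =>
    isProbabilityMeasure_nMeasure hgpos hg (hlpos x)
  have hmem : ∀ x, MemLp (fun k : ℕ => (k : ℝ)) 2 (nMeasure g (lam x)) := fun x =>
    memLp_two_nMeasure hgpos hg (hlpos x)
  set ν := Measure.pi fun x => nMeasure g (lam x) with hν
  have hνint : Integrable (fun η => ∑ x : Fin d → Fin N, (η x : ℝ)) ν :=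
    integrable_finsetSum _ fun x _ => integrable_comp_eval ((hmem x).integrable one_le_two)
  have hNpos : (0 : ℝ) < N := by exact_mod_cast hN
  set c : ℝ := (N : ℝ) ^ (-(d : ℤ)) with hc
  have hcpos : 0 < c := zpow_pos hNpos _
  set S : ((Fin d → Fin N) → ℕ) → ℝ :=
    fun η => |c * ∑ x : Fin d → Fin N, φ x * ((η x : ℝ) - Rfun g (lam x))| with hS
  have hLip : ∀ η ζ : (Fin d → Fin N) → ℕ,
      |S η / B - S ζ / B| ≤ c * ∑ x, |(η x : ℝ) - (ζ x : ℝ)| := fun η ζ => by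
    rw [← sub_div, abs_div, abs_of_pos hB, div_le_iff₀' hB]
    exact abs_weighted_sum_lipschitz hcpos.le φ _ hφ η ζ
  have hdual := (abs_le.1 (abs_integral_sub_le_lipDual hμint hνint hLip)).2
  rw [integral_div, integral_div, ← sub_div, div_le_iff₀ hB] at hdual
  have hSint : Integrable S μ := by
    simpa [div_mul_cancel₀ _ hB.ne'] using (integrable_of_lipschitz hμint hLip).mul_const B
  have hscale : c * √((N : ℝ) ^ d * V) = √V * (N : ℝ) ^ (-(d : ℝ) / 2) := by
    have h1 : √((N : ℝ) ^ d) = (N : ℝ) ^ ((d : ℝ) / 2) := by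
      rw [Real.sqrt_eq_rpow, ← Real.rpow_natCast, ← Real.rpow_mul hNpos.le]
      ring_nf
    have h2 : c = (N : ℝ) ^ (-(d : ℝ)) := by
      rw [hc, ← Real.rpow_intCast]
      push_cast
      rfl
    rw [Real.sqrt_mul (by positivity), h1, h2, ← mul_assoc, ← Real.rpow_add hNpos, mul_comm]
    ring_nf
  have hνS : ∫ η, S η ∂ν ≤ B * (√V * (N : ℝ) ^ (-(d : ℝ) / 2)) := by
    have h := integral_abs_weighted_sum_pi_le hmem
      (fun x => integral_id_nMeasure hgpos hg (hlpos x))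
      (fun x => variance_nMeasure_le hgpos hg (hlpos x) (hlamx x).2) hB.le hφ
    simp only [hS, abs_mul, abs_of_pos hcpos]
    rw [integral_const_mul, ← hscale, mul_left_comm]
    simp only [Fintype.card_fun, Fintype.card_fin, Nat.cast_pow] at h
    exact mul_le_mul_of_nonneg_left h hcpos.le
  have hmarkov : ε * (μ {η | ε < S η}).toReal ≤ ∫ η, S η ∂μ := by
    refine le_trans ?_ (mul_meas_ge_le_integral_of_nonneg
      (Filter.Eventually.of_forall fun η => abs_nonneg _) hSint ε)
    exact mul_le_mul_of_nonneg_left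
      (measureReal_mono fun η (h : ε < S η) => h.le) hε.le
  have hdual0 : 0 ≤ lipDual c μ ν := Real.iSup_nonneg fun _ => abs_nonneg _
  rw [mul_right_comm, ← div_eq_mul_inv, le_div_iff₀ hε, mul_comm]
  refine hmarkov.trans ?_
  have hr : 0 ≤ (N : ℝ) ^ (-(d : ℝ) / 2) := by positivity
  nlinarith [mul_nonneg hB.le (mul_nonneg (Real.sqrt_nonneg V) hdual0), mul_nonneg hB.le hr]
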